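/- arXiv:1305.5621 — 2 statements merged into one kernel-verified Lean document; each statement's English description precedes it below -/
import Mathlib

section
/- Let Π denote the set of Lévy exponents ψ(u) = −((u²+iu)/2)c + ∫(e^{iux} − 1 − iu(e^x−1))K(dx) with c ≥ 0 and K a Lévy measure satisfying ∫_{x>1} e^x K(dx) < ∞. Let A be a Borel subset of ℝ, μ a finite measure on A, and ψ : A × ℝ → ℂ measurable with ψ(r,·) ∈ Π for all r ∈ A and ∫_A sup_{|u|≤m} |ψ(r,u)| μ(dr) < ∞ for all m ∈ ℕ. Then the function u ↦ ∫_A ψ(r,u) μ(dr) belongs to Π. -/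
open MeasureTheory Filter Topology ENNReal

/-- Membership in the class `Π`: `ψ(u) = −((u²+iu)/2)c + ∫(e^{iux} − 1 − iu(eˣ−1)) K(dx)`
for some `c ≥ 0` and Lévy measure `K` with `∫_{x>1} eˣ K(dx) < ∞`. -/
def MemPi (ψ : ℝ → ℂ) : Prop :=
  ∃ (c : ℝ) (K : Measure ℝ), 0 ≤ c ∧ K {0} = 0 ∧
    (∫⁻ x, ENNReal.ofReal (min (x ^ 2) 1) ∂K) < ⊤ ∧
    (∫⁻ x in Set.Ioi (1 : ℝ), ENNReal.ofReal (Real.exp x) ∂K) < ⊤ ∧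
    (∀ u : ℝ, Integrable (fun x : ℝ =>
      Complex.exp (Complex.I * (u : ℂ) * (x : ℂ)) - 1 -
        Complex.I * (u : ℂ) * ((Real.exp x - 1 : ℝ) : ℂ)) K) ∧
    ∀ u : ℝ, ψ u
      = -(((u : ℂ) ^ 2 + Complex.I * (u : ℂ)) / 2) * (c : ℂ)
        + ∫ x, (Complex.exp (Complex.I * (u : ℂ) * (x : ℂ)) - 1 -
            Complex.I * (u : ℂ) * ((Real.exp x - 1 : ℝ) : ℂ)) ∂K

noncomputable def gF (u x : ℝ) : ℂ := Complex.exp (Complex.I * (u : ℂ) * (x : ℂ)) - 1 -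
        Complex.I * (u : ℂ) * ((Real.exp x - 1 : ℝ) : ℂ)

noncomputable def eF (x : ℝ) : ℝ := (Set.Ioi (1:ℝ)).indicator Real.exp x

def IsTrip (ψ : ℝ → ℂ) (c : ℝ) (K : Measure ℝ) : Prop := 0 ≤ c ∧ K {0} = 0 ∧
    (∫⁻ x, ENNReal.ofReal (min (x ^ 2) 1) ∂K) < ⊤ ∧
    (∫⁻ x in Set.Ioi (1 : ℝ), ENNReal.ofReal (Real.exp x) ∂K) < ⊤ ∧
    (∀ u : ℝ, Integrable (fun x : ℝ => gF u x) K) ∧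
    ∀ u : ℝ, ψ u
      = -(((u : ℂ) ^ 2 + Complex.I * (u : ℂ)) / 2) * (c : ℂ)
        + ∫ x, gF u x ∂K

lemma norm_expI (u x : ℝ) : ‖Complex.exp (Complex.I * (u : ℂ) * (x : ℂ))‖ = 1 := by
  have : Complex.I * (u : ℂ) * (x : ℂ) = ((u * x : ℝ) : ℂ) * Complex.I := by
    push_cast; ring
  rw [this, Complex.norm_exp_ofReal_mul_I]

lemma gF_meas (u : ℝ) : Measurable (gF u) := by
  unfold gF; fun_prop

lemma eF_meas : Measurable eF := Real.measurable_exp.indicator measurableSet_Ioi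

lemma eF_nonneg (x : ℝ) : 0 ≤ eF x := Set.indicator_nonneg (fun _ _ => (Real.exp_pos _).le) _

lemma gF_bound_le (u x : ℝ) (hx : x ≤ 1) : ‖gF u x‖ ≤ (3 * u ^ 2 + |u| + 2) * min (x ^ 2) 1 := by
  by_cases hx1 : |x| ≤ 1
  · have hx2 : x ^ 2 ≤ 1 := by rw [← sq_abs]; exact pow_le_one₀ (abs_nonneg _) hx1
    rw [min_eq_left hx2]
    have e1 : gF u x = (Complex.exp (Complex.I * (u : ℂ) * (x : ℂ)) - 1 - Complex.I * (u : ℂ) * (x : ℂ))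
        - Complex.I * (u : ℂ) * ((Real.exp x - 1 - x : ℝ) : ℂ) := by
      unfold gF; push_cast; ring
    have b2 := Real.abs_exp_sub_one_sub_id_le hx1
    have nz : ‖Complex.I * (u : ℂ) * (x : ℂ)‖ = |u * x| := by simp [abs_mul]
    have b1 : ‖Complex.exp (Complex.I * (u : ℂ) * (x : ℂ)) - 1 - Complex.I * (u : ℂ) * (x : ℂ)‖ ≤ 3 * (u * x) ^ 2 := by
      by_cases h : |u * x| ≤ 1
      · have := Complex.norm_exp_sub_one_sub_id_le (x := Complex.I * (u : ℂ) * (x : ℂ)) (by rw [nz]; exact h)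
        rw [nz, sq_abs] at this
        nlinarith [sq_nonneg (u * x)]
      · push Not at h
        have h1 := norm_sub_le (Complex.exp (Complex.I * (u : ℂ) * (x : ℂ)) - 1) (Complex.I * (u : ℂ) * (x : ℂ))
        have h2 := norm_sub_le (Complex.exp (Complex.I * (u : ℂ) * (x : ℂ))) 1
        rw [norm_expI, norm_one] at h2
        rw [nz] at h1
        have : (u * x) ^ 2 = |u * x| ^ 2 := (sq_abs _).symm
        nlinarith
    rw [e1]
    refine (norm_sub_le _ _).trans ?_
    have b3 : ‖Complex.I * (u : ℂ) * ((Real.exp x - 1 - x : ℝ) : ℂ)‖ ≤ |u| * x ^ 2 := by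
      rw [norm_mul, norm_mul, Complex.norm_I, Complex.norm_real, Complex.norm_real, one_mul]
      exact mul_le_mul_of_nonneg_left b2 (abs_nonneg _)
    nlinarith [sq_nonneg x]
  · have hx' : x < -1 := by
      by_contra hc
      push Not at hc
      exact hx1 (abs_le.2 ⟨hc, hx⟩)
    rw [min_eq_right (by nlinarith), mul_one]
    have h1 := norm_sub_le (Complex.exp (Complex.I * (u : ℂ) * (x : ℂ)) - 1) (Complex.I * (u : ℂ) * ((Real.exp x - 1 : ℝ) : ℂ))
    have h2 := norm_sub_le (Complex.exp (Complex.I * (u : ℂ) * (x : ℂ))) 1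
    rw [norm_expI, norm_one] at h2
    rw [norm_mul, norm_mul, Complex.norm_I, Complex.norm_real, Complex.norm_real, one_mul] at h1
    have h3 : ‖Real.exp x - 1‖ ≤ 1 := by
      rw [Real.norm_eq_abs, abs_le]
      have := Real.exp_pos x
      have := Real.exp_le_one_iff.2 (show x ≤ 0 by linarith)
      constructor <;> linarith
    have h4 := mul_le_mul_of_nonneg_left h3 (norm_nonneg u)
    rw [Real.norm_eq_abs u] at h4 h1
    unfold gF
    nlinarith [sq_nonneg u]

lemma gF_bound (u x : ℝ) : ‖gF u x‖ ≤ (3 * u ^ 2 + |u| + 2) * (min (x ^ 2) 1 + eF x) := by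
  have hC : 0 ≤ 3 * u ^ 2 + |u| + 2 := by positivity
  have hm : 0 ≤ min (x ^ 2) 1 := le_min (sq_nonneg _) zero_le_one
  by_cases hx : x ≤ 1
  · refine (gF_bound_le u x hx).trans ?_
    exact mul_le_mul_of_nonneg_left (by linarith [eF_nonneg x]) hC
  · push Not at hx
    have he : eF x = Real.exp x := Set.indicator_of_mem (Set.mem_Ioi.2 hx) _
    rw [he]
    have h1 := norm_sub_le (Complex.exp (Complex.I * (u : ℂ) * (x : ℂ)) - 1) (Complex.I * (u : ℂ) * ((Real.exp x - 1 : ℝ) : ℂ))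
    have h2 := norm_sub_le (Complex.exp (Complex.I * (u : ℂ) * (x : ℂ))) 1
    rw [norm_expI, norm_one] at h2
    rw [norm_mul, norm_mul, Complex.norm_I, Complex.norm_real, Complex.norm_real, one_mul] at h1
    have e1 : 1 ≤ Real.exp x := Real.one_le_exp (by linarith)
    have h3 : ‖Real.exp x - 1‖ ≤ Real.exp x := by
      rw [Real.norm_eq_abs, abs_le]
      constructor <;> linarith
    have h4 := mul_le_mul_of_nonneg_left h3 (norm_nonneg u)
    rw [Real.norm_eq_abs u] at h4 h1
    have h5 : (|u| + 2) * Real.exp x ≤ (3 * u ^ 2 + |u| + 2) * (min (x ^ 2) 1 + Real.exp x) :=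
      mul_le_mul (by nlinarith [sq_nonneg u]) (by linarith) (by linarith) hC
    unfold gF
    nlinarith

lemma gF_re (u x : ℝ) : (gF u x).re = Real.cos (u * x) - 1 := by
  have : Complex.I * (u : ℂ) * (x : ℂ) = ((u * x : ℝ) : ℂ) * Complex.I := by
    push_cast; ring
  unfold gF
  rw [this, Complex.sub_re, Complex.sub_re, Complex.exp_ofReal_mul_I_re]
  simp

lemma gF_im (u x : ℝ) : (gF u x).im = Real.sin (u * x) - u * (Real.exp x - 1) := by
  have : Complex.I * (u : ℂ) * (x : ℂ) = ((u * x : ℝ) : ℂ) * Complex.I := by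
    push_cast; ring
  unfold gF
  rw [this, Complex.sub_im, Complex.sub_im, Complex.exp_ofReal_mul_I_im]
  simp [Complex.exp_ofReal_re]

lemma eF_le (x : ℝ) : eF x ≤ 4 * (-(gF 1 x).im) + 24 * min (x ^ 2) 1 := by
  by_cases hx : x ≤ 1
  · have he : eF x = 0 := Set.indicator_of_notMem (by simpa using hx) _
    have := gF_bound_le 1 x hx
    have h2 := (Complex.abs_im_le_norm (gF 1 x))
    have h3 := le_abs_self (gF 1 x).im
    norm_num at this
    rw [he]; linarith
  · push Not at hx
    have he : eF x = Real.exp x := Set.indicator_of_mem (Set.mem_Ioi.2 hx) _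
    rw [he, gF_im]
    have hm : 0 ≤ min (x ^ 2) 1 := le_min (sq_nonneg _) zero_le_one
    have h1 := Real.exp_one_gt_d9
    have h2 := Real.exp_le_exp.2 hx.le
    have h3 := Real.sin_le_one (1 * x)
    linarith

lemma gF_diff (u a x : ℝ) : gF u x - (gF (u + a) x + gF (u - a) x) / 2 =
    Complex.exp (Complex.I * (u : ℂ) * (x : ℂ)) * ((1 - Real.cos (a * x) : ℝ) : ℂ) := by
  unfold gF
  push_cast
  have e1 : Complex.I * ((u : ℂ) + a) * x = Complex.I * u * x + (a * x) * Complex.I := by ring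
  have e2 : Complex.I * ((u : ℂ) - a) * x = Complex.I * u * x + -(a * x) * Complex.I := by ring
  rw [e1, e2, Complex.exp_add, Complex.exp_add, Complex.cos]
  ring

lemma sinc_pos {x : ℝ} (hx : 0 < x) : min (x ^ 2) 1 ≤ 40 * (1 - Real.sin x / x) := by
  by_cases h2 : x ≤ 2
  · refine (min_le_left _ _).trans ?_
    have hy : |x / 2| ≤ 1 := by rw [abs_of_pos (by linarith)]; linarith
    have hb := (abs_le.1 (Real.sin_bound hy)).2
    rw [abs_of_pos (show 0 < x / 2 by linarith)] at hb
    have hs : Real.sin x ≤ 2 * Real.sin (x / 2) := by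
      have : Real.sin x = 2 * Real.sin (x / 2) * Real.cos (x / 2) := by
        rw [← Real.sin_two_mul]; ring_nf
      rw [this]
      have h0 : 0 ≤ Real.sin (x / 2) := Real.sin_nonneg_of_nonneg_of_le_pi (by linarith)
        (by linarith [Real.pi_gt_three])
      nlinarith [Real.cos_le_one (x / 2)]
    have h5 : x ^ 5 ≤ 4 * x ^ 3 := by
      have : x ^ 2 ≤ 4 := by nlinarith
      have h3 : 0 < x ^ 3 := by positivity
      nlinarith
    have : Real.sin x / x ≤ 1 - x ^ 2 / 40 := by
      rw [div_le_iff₀ hx]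
      have : 0 < x ^ 3 := by positivity
      nlinarith
    linarith
  · push Not at h2
    refine (min_le_right _ _).trans ?_
    have : Real.sin x / x ≤ 1 / 2 := by
      rw [div_le_iff₀ hx]
      linarith [Real.sin_le_one x]
    linarith

lemma sinc_ne {x : ℝ} (hx : x ≠ 0) : min (x ^ 2) 1 ≤ 40 * (1 - Real.sin x / x) := by
  rcases lt_or_gt_of_ne hx with h | h
  · have := sinc_pos (neg_pos.2 h)
    simpa [Real.sin_neg, neg_div_neg_eq] using this
  · exact sinc_pos h

lemma lint_cos {x : ℝ} (hx : x ≠ 0) : ENNReal.ofReal (min (x ^ 2) 1) ≤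
    40 * ∫⁻ a in Set.Icc (0:ℝ) 1, ENNReal.ofReal (1 - Real.cos (a * x)) := by
  have h1 : ∫ a in (0:ℝ)..1, (1 - Real.cos (a * x)) = 1 - Real.sin x / x := by
    rw [intervalIntegral.integral_sub intervalIntegrable_const (by apply Continuous.intervalIntegrable; fun_prop)]
    rw [intervalIntegral.integral_comp_mul_right _ hx]
    simp
    field_simp
  rw [intervalIntegral.integral_of_le zero_le_one, ← integral_Icc_eq_integral_Ioc] at h1
  have hi : IntegrableOn (fun a : ℝ => 1 - Real.cos (a * x)) (Set.Icc 0 1) :=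
    Continuous.integrableOn_Icc (by fun_prop)
  rw [← ofReal_integral_eq_lintegral_ofReal hi (ae_of_all _ fun a => sub_nonneg.2 (Real.cos_le_one _)), h1]
  rw [show (40 : ℝ≥0∞) = ENNReal.ofReal 40 by simp, ← ENNReal.ofReal_mul (by norm_num)]
  exact ENNReal.ofReal_le_ofReal (sinc_ne hx)

lemma cos_irr {x : ℝ} (hx : x ≠ 0) : 0 < (1 - Real.cos (1 * x)) + (1 - Real.cos (√2 * x)) := by
  have h1 := Real.cos_le_one (1 * x)
  have h2 := Real.cos_le_one (√2 * x)
  by_contra hc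
  push Not at hc
  have c1 : Real.cos (1 * x) = 1 := by linarith
  have c2 : Real.cos (√2 * x) = 1 := by linarith
  rw [one_mul, Real.cos_eq_one_iff] at c1
  rw [Real.cos_eq_one_iff] at c2
  obtain ⟨n, hn⟩ := c1
  obtain ⟨m, hm⟩ := c2
  have hn0 : (n : ℝ) ≠ 0 := by
    rintro h; rw [h] at hn; apply hx; linarith
  have : (n : ℝ) * √2 = m := by
    have hp := Real.pi_pos.ne'
    rw [← hn] at hm
    have : (2 * Real.pi) * (m - n * √2) = 0 := by linarith
    have := (mul_eq_zero.1 this).resolve_left (by positivity)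
    linarith
  refine irrational_sqrt_two ⟨(m : ℚ) / n, ?_⟩
  push_cast
  field_simp
  linarith

lemma meas_schwartz (M : ℝ → Measure ℝ) [∀ r, IsFiniteMeasure (M r)]
    (φ : ℝ → ℝ → ℂ) (hφ : Measurable (Function.uncurry φ))
    (h : ∀ (r u : ℝ), ∫ x, Complex.exp (Complex.I * (u : ℂ) * (x : ℂ)) ∂(M r) = φ r u)
    (f : SchwartzMap ℝ ℂ) : Measurable (fun r => ∫ x, f x ∂(M r)) := by
  have hinv : ∀ x : ℝ, f x = ∫ v : ℝ, Complex.exp (Complex.I * ((2 * Real.pi * v : ℝ) : ℂ) * (x : ℂ)) * (FourierTransform.fourier f) v := by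
    intro x
    conv_lhs => rw [← FourierTransform.fourierInv_fourier_eq (F := SchwartzMap ℝ ℂ) f]
    rw [SchwartzMap.fourierInv_coe, Real.fourierInv_eq']
    congr 1
    ext v
    simp only [smul_eq_mul]
    congr 2
    simp
    ring
  have key : ∀ r, ∫ x, f x ∂(M r) = ∫ v : ℝ, φ r (2 * Real.pi * v) * (FourierTransform.fourier f) v := by
    intro r
    simp_rw [hinv]
    rw [integral_integral_swap]
    · congr 1
      ext v
      rw [integral_mul_const, h]
    · have h1 : Integrable (fun p : ℝ × ℝ => (FourierTransform.fourier f) p.2) ((M r).prod volume) :=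
        (SchwartzMap.integrable _).comp_snd (M r)
      refine h1.mono ?_ (ae_of_all _ ?_)
      · refine AEStronglyMeasurable.mul ?_ h1.1
        refine Continuous.aestronglyMeasurable ?_
        fun_prop
      · rintro ⟨x, v⟩
        have : Complex.I * ((2 * Real.pi * v : ℝ) : ℂ) * (x : ℂ) = ((2 * Real.pi * v * x : ℝ) : ℂ) * Complex.I := by
          push_cast; ring
        simp only [Function.uncurry, norm_mul]
        rw [this, Complex.norm_exp_ofReal_mul_I, one_mul]
  simp_rw [key]
  refine StronglyMeasurable.measurable ?_
  refine StronglyMeasurable.integral_prod_right (f := fun r v => φ r (2 * Real.pi * v) * (FourierTransform.fourier f) v) ?_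
  refine Measurable.stronglyMeasurable ?_
  refine Measurable.mul ?_ ?_
  · exact hφ.comp (f := fun p : ℝ × ℝ => (p.1, 2 * Real.pi * p.2)) (by fun_prop)
  · exact (SchwartzMap.continuous _).measurable.comp measurable_snd

lemma meas_kernel (M : ℝ → Measure ℝ) [∀ r, IsFiniteMeasure (M r)]
    (φ : ℝ → ℝ → ℂ) (hφ : Measurable (Function.uncurry φ))
    (h : ∀ (r u : ℝ), ∫ x, Complex.exp (Complex.I * (u : ℂ) * (x : ℂ)) ∂(M r) = φ r u) :
    Measurable M := by
  refine Measurable.measure_of_isPiSystem (S := (⋃ (a : ℚ) (b : ℚ) (_ : a < b), {Set.Ioo (a : ℝ) (b : ℝ)}))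
    ((BorelSpace.measurable_eq (α := ℝ)).trans Real.borel_eq_generateFrom_Ioo_rat) Real.isPiSystem_Ioo_rat ?_ ?_
  · intro s hs
    simp only [Set.mem_iUnion, Set.mem_singleton_iff] at hs
    obtain ⟨a, b, -, rfl⟩ := hs
    obtain ⟨f, fs, fd, fr⟩ := (isOpen_Ioo (a := (a : ℝ)) (b := b)).exists_contDiff_support_eq (n := ⊤)
    have f01 : ∀ x, f x ∈ Set.Icc (0:ℝ) 1 := fun x => fr ⟨x, rfl⟩
    let F : ℕ → ℝ → ℂ := fun n x => ((1 - (1 - f x) ^ n : ℝ) : ℂ)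
    have Fc : ∀ n, HasCompactSupport (F n) := by
      intro n
      refine HasCompactSupport.of_support_subset_isCompact (isCompact_Icc (a := (a:ℝ)) (b := b)) ?_
      intro x hx
      have : x ∈ f.support := by
        intro h0
        apply hx
        simp [F, h0]
      rw [fs] at this
      exact Set.Ioo_subset_Icc_self this
    have Fd : ∀ n, ContDiff ℝ (⊤ : ℕ∞) (F n) := by
      intro n
      refine Complex.ofRealCLM.contDiff.comp ?_
      exact contDiff_const.sub ((contDiff_const.sub fd).pow n)
    have hm : ∀ n, Measurable (fun r => ∫ x, F n x ∂(M r)) := fun n =>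
      meas_schwartz M φ hφ h ((Fc n).toSchwartzMap (Fd n))
    have hlim : ∀ r, Tendsto (fun n => ∫ x, F n x ∂(M r)) atTop
        (𝓝 (∫ x, (Set.Ioo (a:ℝ) b).indicator (fun _ => (1:ℂ)) x ∂(M r))) := by
      intro r
      refine tendsto_integral_of_dominated_convergence (fun _ => 1) ?_ (integrable_const _) ?_ ?_
      · exact fun n => (Fd n).continuous.aestronglyMeasurable
      · intro n
        refine ae_of_all _ fun x => ?_
        obtain ⟨h0, h1⟩ := f01 x
        simp only [F, Complex.norm_real, Real.norm_eq_abs]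
        have := pow_le_one₀ (n := n) (sub_nonneg.2 h1) (by linarith)
        have := pow_nonneg (sub_nonneg.2 h1) n
        rw [abs_le]; constructor <;> linarith
      · refine ae_of_all _ fun x => ?_
        obtain ⟨h0, h1⟩ := f01 x
        by_cases hx : x ∈ Set.Ioo (a:ℝ) b
        · have h0' : f x ≠ 0 := by rw [← fs] at hx; exact hx
          have h0 : 0 < f x := lt_of_le_of_ne h0 h0'.symm
          rw [Set.indicator_of_mem hx]
          have := tendsto_pow_atTop_nhds_zero_of_lt_one (sub_nonneg.2 h1) (by linarith)
          have := (Complex.continuous_ofReal.tendsto _).comp (this.const_sub 1)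
          simpa [F, Function.comp_def] using this
        · have h0' : f x = 0 := by
            by_contra hne
            exact hx (fs ▸ hne)
          rw [Set.indicator_of_notMem hx]
          simp [F, h0']
    have hmeas := measurable_of_tendsto_metrizable hm (tendsto_pi_nhds.2 hlim)
    have : (fun r => M r (Set.Ioo (a:ℝ) b)) = fun r => ENNReal.ofReal (∫ x, (Set.Ioo (a:ℝ) b).indicator (fun _ => (1:ℂ)) x ∂(M r)).re := by
      ext r
      rw [integral_indicator measurableSet_Ioo]
      simp [Measure.real]
    rw [this]
    fun_prop
  · have : (fun r => M r Set.univ) = fun r => ENNReal.ofReal (φ r 0).re := by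
      ext r
      rw [← h]
      simp [Measure.real]
    rw [this]
    have : Measurable fun r => φ r 0 := hφ.comp (f := fun r => (r, (0:ℝ))) (by fun_prop)
    fun_prop

section trip
variable {ψ : ℝ → ℂ} {c : ℝ} {K : Measure ℝ}

lemma IsTrip.sfinite (h : IsTrip ψ c K) : SFinite K := by
  obtain ⟨-, h0, h1, -⟩ := h
  have : IsFiniteMeasure (K.withDensity fun x => ENNReal.ofReal (min (x ^ 2) 1)) :=
    isFiniteMeasure_withDensity h1.ne
  have hk := withDensity_inv_same (μ := K) (f := fun x : ℝ => ENNReal.ofReal (min (x ^ 2) 1))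
    (by fun_prop) (by
      have : ∀ᵐ x ∂K, x ≠ 0 := by rw [ae_iff]; simpa using h0
      filter_upwards [this] with x hx
      have : 0 < min (x ^ 2) 1 := lt_min (by positivity) one_pos
      simpa using hx) (ae_of_all _ fun _ => ENNReal.ofReal_ne_top)
  rw [← hk]
  infer_instance

lemma IsTrip.diff_int (h : IsTrip ψ c K) (u a : ℝ) : Integrable (fun x : ℝ =>
    Complex.exp (Complex.I * (u : ℂ) * (x : ℂ)) * ((1 - Real.cos (a * x) : ℝ) : ℂ)) K := by
  obtain ⟨-, -, -, -, hi, -⟩ := h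
  simp_rw [← gF_diff]
  exact (hi u).sub (((hi _).add (hi _)).div_const 2)

lemma IsTrip.cos_int (h : IsTrip ψ c K) (a : ℝ) : Integrable (fun x : ℝ => 1 - Real.cos (a * x)) K := by
  have := (h.diff_int 0 a).re
  refine this.congr (ae_of_all _ fun x => ?_)
  simp only [Complex.ofReal_zero, mul_zero, zero_mul, Complex.exp_zero, one_mul]
  exact Complex.ofReal_re _

lemma IsTrip.diff (h : IsTrip ψ c K) (u a : ℝ) :
    ψ u - (ψ (u + a) + ψ (u - a)) / 2 = ∫ x : ℝ, Complex.exp (Complex.I * (u : ℂ) * (x : ℂ)) *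
      ((1 - Real.cos (a * x) : ℝ) : ℂ) ∂K + ((c * a ^ 2 / 2 : ℝ) : ℂ) := by
  obtain ⟨-, -, -, -, hi, hf⟩ := h
  simp_rw [← gF_diff]
  have hi2 : Integrable (fun x => (gF (u + a) x + gF (u - a) x) / 2) K :=
    ((hi _).add (hi _)).div_const 2
  rw [integral_sub (hi u) hi2, integral_div, integral_add (hi _) (hi _),
    hf, hf, hf]
  push_cast
  ring

lemma IsTrip.re (h : IsTrip ψ c K) (a : ℝ) :
    -(ψ a).re = ∫ x : ℝ, (1 - Real.cos (a * x)) ∂K + c * a ^ 2 / 2 := by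
  obtain ⟨-, -, -, -, hi, hf⟩ := h
  have h1 : ∫ x, (gF a x).re ∂K = (∫ x, gF a x ∂K).re := integral_re (hi a)
  have h2 : ∫ x : ℝ, (1 - Real.cos (a * x)) ∂K = - ∫ x, (gF a x).re ∂K := by
    rw [← integral_neg]; congr 1; ext x; rw [gF_re]; ring
  rw [h2, h1, hf, Complex.add_re, ← Complex.ofReal_pow]
  simp [-Complex.ofReal_pow]
  ring

lemma IsTrip.lint_cos_le (h : IsTrip ψ c K) (a : ℝ) :
    ∫⁻ x : ℝ, ENNReal.ofReal (1 - Real.cos (a * x)) ∂K ≤ ‖ψ a‖ₑ := by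
  rw [← ofReal_integral_eq_lintegral_ofReal (h.cos_int a) (ae_of_all _ fun x => sub_nonneg.2 (Real.cos_le_one _)),
    ← ofReal_norm]
  apply ENNReal.ofReal_le_ofReal
  have h1 := h.re a
  have h2 : 0 ≤ c * a ^ 2 / 2 := by have := h.1; positivity
  have h3 := Complex.abs_re_le_norm (ψ a)
  have h4 := neg_abs_le (ψ a).re
  linarith

lemma IsTrip.c_le (h : IsTrip ψ c K) : c ≤ 2 * ‖ψ 1‖ := by
  have h1 := h.re 1
  have h2 : 0 ≤ ∫ x : ℝ, (1 - Real.cos (1 * x)) ∂K :=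
    integral_nonneg fun x => sub_nonneg.2 (Real.cos_le_one _)
  have h3 := Complex.abs_re_le_norm (ψ 1)
  have h4 := neg_abs_le (ψ 1).re
  linarith

lemma IsTrip.lint_min_le (h : IsTrip ψ c K) :
    ∫⁻ x : ℝ, ENNReal.ofReal (min (x ^ 2) 1) ∂K ≤
      40 * ⨆ u ∈ Set.Icc (-((1 : ℕ) : ℝ)) ((1 : ℕ) : ℝ), (‖ψ u‖₊ : ℝ≥0∞) := by
  have := h.sfinite
  have h0 : ∀ᵐ x ∂K, x ≠ 0 := by rw [ae_iff]; simpa using h.2.1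
  calc ∫⁻ x : ℝ, ENNReal.ofReal (min (x ^ 2) 1) ∂K
      ≤ ∫⁻ x : ℝ, 40 * (∫⁻ a in Set.Icc (0:ℝ) 1, ENNReal.ofReal (1 - Real.cos (a * x))) ∂K := by
        refine lintegral_mono_ae ?_
        filter_upwards [h0] with x hx using lint_cos hx
    _ = 40 * ∫⁻ x : ℝ, (∫⁻ a in Set.Icc (0:ℝ) 1, ENNReal.ofReal (1 - Real.cos (a * x))) ∂K :=
        lintegral_const_mul' _ _ (by simp)
    _ = 40 * ∫⁻ a in Set.Icc (0:ℝ) 1, ∫⁻ x : ℝ, ENNReal.ofReal (1 - Real.cos (a * x)) ∂K := by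
        rw [lintegral_lintegral_swap]
        refine Measurable.aemeasurable ?_
        fun_prop
    _ ≤ 40 * ∫⁻ a in Set.Icc (0:ℝ) 1, (⨆ u ∈ Set.Icc (-((1 : ℕ) : ℝ)) ((1 : ℕ) : ℝ), (‖ψ u‖₊ : ℝ≥0∞)) := by
        gcongr 40 * ?_
        refine setLIntegral_mono' measurableSet_Icc fun a ha => ?_
        refine (h.lint_cos_le a).trans ?_
        refine le_iSup₂_of_le a ?_ le_rfl
        simp only [Set.mem_Icc] at ha ⊢
        push_cast
        constructor <;> linarith
    _ = _ := by simp

lemma lint_eF (K : Measure ℝ) : ∫⁻ x in Set.Ioi (1 : ℝ), ENNReal.ofReal (Real.exp x) ∂K =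
    ∫⁻ x, ENNReal.ofReal (eF x) ∂K := by
  rw [← lintegral_indicator measurableSet_Ioi]
  congr 1
  ext x
  unfold eF
  by_cases hx : x ∈ Set.Ioi (1:ℝ)
  · simp only [Set.indicator_of_mem hx]
  · simp only [Set.indicator_of_notMem hx, ENNReal.ofReal_zero]

lemma IsTrip.lint_exp_le (h : IsTrip ψ c K) :
    ∫⁻ x in Set.Ioi (1 : ℝ), ENNReal.ofReal (Real.exp x) ∂K ≤
      4 * ‖ψ 1‖ₑ + 24 * ∫⁻ x : ℝ, ENNReal.ofReal (min (x ^ 2) 1) ∂K := by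
  rw [lint_eF]
  obtain ⟨hc, -, h1, h2, hi, hf⟩ := h
  have hm : ∀ x : ℝ, 0 ≤ min (x ^ 2) 1 := fun x => le_min (sq_nonneg _) zero_le_one
  have i1 : Integrable (fun x : ℝ => min (x ^ 2) 1) K := by
    refine ⟨by fun_prop, ?_⟩
    rw [hasFiniteIntegral_iff_ofReal (ae_of_all _ hm)]
    exact h1
  rw [lint_eF] at h2
  have i2 : Integrable eF K := by
    refine ⟨eF_meas.aestronglyMeasurable, ?_⟩
    rw [hasFiniteIntegral_iff_ofReal (ae_of_all _ eF_nonneg)]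
    exact h2
  have i3 : Integrable (fun x => (gF 1 x).im) K := (hi 1).im
  have e3 : ∫ x, (gF 1 x).im ∂K = (∫ x, gF 1 x ∂K).im := integral_im (hi 1)
  rw [← ofReal_integral_eq_lintegral_ofReal i1 (ae_of_all _ hm),
    ← ofReal_integral_eq_lintegral_ofReal i2 (ae_of_all _ eF_nonneg), ← ofReal_norm,
    show (4 : ℝ≥0∞) = ENNReal.ofReal 4 by simp, show (24 : ℝ≥0∞) = ENNReal.ofReal 24 by simp,
    ← ENNReal.ofReal_mul (by norm_num), ← ENNReal.ofReal_mul (by norm_num),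
    ← ENNReal.ofReal_add (by positivity) (mul_nonneg (by norm_num) (integral_nonneg hm))]
  apply ENNReal.ofReal_le_ofReal
  have hle : ∫ x, eF x ∂K ≤ ∫ x, (4 * (-(gF 1 x).im) + 24 * min (x ^ 2) 1) ∂K :=
    integral_mono i2 ((i3.neg.const_mul 4).add (i1.const_mul 24)) eF_le
  have i4 : Integrable (fun x => 4 * (-(gF 1 x).im)) K := i3.neg.const_mul 4
  rw [integral_add i4 (i1.const_mul 24), integral_const_mul, integral_const_mul,
    integral_neg, e3] at hle
  have him := congrArg Complex.im (hf 1)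
  rw [Complex.add_im] at him
  have : (-((((1 : ℝ) : ℂ) ^ 2 + Complex.I * ((1 : ℝ) : ℂ)) / 2) * (c : ℂ)).im = - c / 2 := by
    simp
    ring
  rw [this] at him
  have h3 := Complex.abs_im_le_norm (ψ 1)
  have h4 := neg_abs_le (ψ 1).im
  linarith

/-- The finite measure whose characteristic function is the second difference of `ψ`. -/
noncomputable def nM (c : ℝ) (K : Measure ℝ) (a : ℝ) : Measure ℝ :=
  K.withDensity (fun x => ENNReal.ofReal (1 - Real.cos (a * x))) +
    ENNReal.ofReal (c * a ^ 2 / 2) • Measure.dirac 0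

lemma IsTrip.fin_wd (h : IsTrip ψ c K) (a : ℝ) :
    IsFiniteMeasure (K.withDensity (fun x => ENNReal.ofReal (1 - Real.cos (a * x)))) :=
  isFiniteMeasure_withDensity ((h.lint_cos_le a).trans_lt enorm_lt_top).ne

lemma IsTrip.fin_nM (h : IsTrip ψ c K) (a : ℝ) : IsFiniteMeasure (nM c K a) := by
  have := h.fin_wd a
  have : IsFiniteMeasure (ENNReal.ofReal (c * a ^ 2 / 2) • (Measure.dirac 0 : Measure ℝ)) :=
    Measure.smul_finite _ ENNReal.ofReal_ne_top
  unfold nM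
  infer_instance

lemma expI_int (M : Measure ℝ) [IsFiniteMeasure M] (u : ℝ) :
    Integrable (fun x : ℝ => Complex.exp (Complex.I * (u : ℂ) * (x : ℂ))) M := by
  refine (integrable_const (1:ℝ)).mono' (by apply Continuous.aestronglyMeasurable; fun_prop) (ae_of_all _ fun x => ?_)
  rw [norm_expI]

lemma IsTrip.char_nM (h : IsTrip ψ c K) (a u : ℝ) :
    ∫ x : ℝ, Complex.exp (Complex.I * (u : ℂ) * (x : ℂ)) ∂(nM c K a) =
      ψ u - (ψ (u + a) + ψ (u - a)) / 2 := by
  have := h.fin_wd a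
  have : IsFiniteMeasure (ENNReal.ofReal (c * a ^ 2 / 2) • (Measure.dirac 0 : Measure ℝ)) :=
    Measure.smul_finite _ ENNReal.ofReal_ne_top
  have h2 : 0 ≤ c * a ^ 2 / 2 := by have := h.1; positivity
  rw [h.diff, nM, integral_add_measure (expI_int _ _) (expI_int _ _)]
  congr 1
  · rw [integral_withDensity_eq_integral_toReal_smul (by fun_prop) (ae_of_all _ fun _ => ENNReal.ofReal_lt_top)]
    congr 1
    ext x
    rw [ENNReal.toReal_ofReal (sub_nonneg.2 (Real.cos_le_one _)), Complex.real_smul, mul_comm]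
  · rw [integral_smul_measure, integral_dirac, ENNReal.toReal_ofReal h2]
    simp

lemma IsTrip.c_eq (h : IsTrip ψ c K) : c = 2 * (nM c K 1 {0}).toReal := by
  have hc := h.1
  rw [nM]
  simp only [Measure.add_apply, Measure.smul_apply, smul_eq_mul]
  rw [withDensity_absolutelyContinuous _ _ h.2.1]
  simp [ENNReal.toReal_ofReal (show 0 ≤ c / 2 by positivity)]
  ring

lemma IsTrip.K_eq (h : IsTrip ψ c K) (s : Set ℝ) (hs : MeasurableSet s) :
    K s = ∫⁻ x in s \ {0}, (ENNReal.ofReal ((1 - Real.cos (1 * x)) + (1 - Real.cos (√2 * x))))⁻¹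
      ∂(nM c K 1) + ∫⁻ x in s \ {0}, (ENNReal.ofReal ((1 - Real.cos (1 * x)) + (1 - Real.cos (√2 * x))))⁻¹
      ∂(nM c K (√2)) := by
  have hs0 : MeasurableSet (s \ {0}) := hs.diff (measurableSet_singleton 0)
  have hr : ∀ a, (nM c K a).restrict (s \ {0}) =
      (K.restrict (s \ {0})).withDensity (fun x => ENNReal.ofReal (1 - Real.cos (a * x))) := by
    intro a
    classical
    rw [nM, Measure.restrict_add, restrict_withDensity hs0, Measure.restrict_smul,
      restrict_dirac' hs0]
    simp
  have hK : K s = K (s \ {0}) := by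
    refine (measure_sdiff_null h.2.1).symm
  rw [hr, hr, lintegral_withDensity_eq_lintegral_mul _ (by fun_prop) (by fun_prop),
    lintegral_withDensity_eq_lintegral_mul _ (by fun_prop) (by fun_prop), ← lintegral_add_left (by fun_prop),
    hK, ← setLIntegral_one]
  refine setLIntegral_congr_fun hs0 fun x hx => ?_
  have hp := cos_irr (x := x) (by simpa using hx.2)
  simp only [Pi.mul_apply]
  rw [← add_mul, ← ENNReal.ofReal_add (sub_nonneg.2 (Real.cos_le_one _)) (sub_nonneg.2 (Real.cos_le_one _)),
    ENNReal.mul_inv_cancel (by simpa using hp) ENNReal.ofReal_ne_top]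

end trip

lemma trip_meas (ψ : ℝ → ℝ → ℂ) (hψ : Measurable (Function.uncurry ψ)) (c : ℝ → ℝ) (K : ℝ → Measure ℝ)
    (h : ∀ r, IsTrip (ψ r) (c r) (K r)) : Measurable c ∧ Measurable K := by
  have hN : ∀ a, Measurable (fun r => nM (c r) (K r) a) := by
    intro a
    have : ∀ r, IsFiniteMeasure (nM (c r) (K r) a) := fun r => (h r).fin_nM a
    refine meas_kernel _ (fun r u => ψ r u - (ψ r (u + a) + ψ r (u - a)) / 2) ?_ fun r u => (h r).char_nM a u
    have h1 : Measurable fun p : ℝ × ℝ => ψ p.1 p.2 := hψ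
    have h2 : Measurable fun p : ℝ × ℝ => ψ p.1 (p.2 + a) :=
      hψ.comp (f := fun p : ℝ × ℝ => (p.1, p.2 + a)) (by fun_prop)
    have h3 : Measurable fun p : ℝ × ℝ => ψ p.1 (p.2 - a) :=
      hψ.comp (f := fun p : ℝ × ℝ => (p.1, p.2 - a)) (by fun_prop)
    exact h1.sub ((h2.add h3).div_const 2)
  constructor
  · have : c = fun r => 2 * (nM (c r) (K r) 1 {0}).toReal := funext fun r => (h r).c_eq
    rw [this]
    have := (Measure.measurable_coe (measurableSet_singleton (0:ℝ))).comp (hN 1)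
    exact (this.ennreal_toReal).const_mul 2
  · refine Measure.measurable_of_measurable_coe _ fun s hs => ?_
    have hs0 : MeasurableSet (s \ {0}) := hs.diff (measurableSet_singleton 0)
    rw [show (fun r => K r s) = _ from funext fun r => (h r).K_eq s hs]
    simp_rw [← lintegral_indicator hs0]
    have hm : Measurable ((s \ {0}).indicator fun x : ℝ =>
      (ENNReal.ofReal ((1 - Real.cos (1 * x)) + (1 - Real.cos (√2 * x))))⁻¹) :=
      Measurable.indicator (by fun_prop) hs0
    exact ((Measure.measurable_lintegral hm).comp (hN 1)).add ((Measure.measurable_lintegral hm).comp (hN _))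

lemma isTrip_zero : IsTrip (fun _ => 0) 0 0 := by
  refine ⟨le_rfl, by simp, by simp, by simp, fun u => integrable_zero_measure, by simp⟩

/-- `Π` is stable under mixing: if `A ⊆ ℝ` is Borel, `μ` a finite
measure concentrated on `A`, `ψ(r,·) ∈ Π` for every `r ∈ A`, and
`∫_A sup_{|u|≤m} |ψ(r,u)| μ(dr) < ∞` for every `m ∈ ℕ`, then
`u ↦ ∫_A ψ(r,u) μ(dr)` is in `Π`. -/
theorem stmt15 (A : Set ℝ) (hA : MeasurableSet A) (μ : Measure ℝ) [IsFiniteMeasure μ]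
    (hμA : μ Aᶜ = 0) (ψ : ℝ → ℝ → ℂ)
    (hψmeas : Measurable (Function.uncurry ψ))
    (hψPi : ∀ r ∈ A, MemPi (ψ r))
    (hint : ∀ m : ℕ,
      ∫⁻ r in A, (⨆ u ∈ Set.Icc (-(m : ℝ)) (m : ℝ), (‖ψ r u‖₊ : ℝ≥0∞)) ∂μ < ⊤) :
    MemPi (fun u => ∫ r in A, ψ r u ∂μ) := by
  classical
  let ψ' : ℝ → ℝ → ℂ := fun r => if r ∈ A then ψ r else fun _ => 0
  have hψ'A : ∀ r ∈ A, ψ' r = ψ r := fun r hr => if_pos hr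
  have hex : ∀ r, ∃ c K, IsTrip (ψ' r) c K := by
    intro r
    by_cases hr : r ∈ A
    · rw [hψ'A r hr]; exact hψPi r hr
    · have : ψ' r = fun _ => 0 := if_neg hr
      rw [this]; exact ⟨0, 0, isTrip_zero⟩
  choose c K hT using hex
  have hψ'm : Measurable (Function.uncurry ψ') := by
    have : Function.uncurry ψ' = fun p => if p.1 ∈ A then Function.uncurry ψ p else 0 := by
      ext ⟨r, u⟩
      by_cases hr : r ∈ A <;> simp [ψ', hr]
    rw [this]
    exact Measurable.ite (measurable_fst hA) hψmeas measurable_const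
  obtain ⟨hcm, hKm⟩ := trip_meas ψ' hψ'm c K hT
  have hψ'u : ∀ u, Measurable (fun r => ψ' r u) := fun u =>
    hψ'm.comp (f := fun r => (r, u)) (by fun_prop)
  set ν := μ.restrict A with hν
  have hνA : ∀ᵐ r ∂ν, r ∈ A := ae_restrict_mem hA
  have hfin : ∀ u, ∫⁻ r, ‖ψ' r u‖ₑ ∂ν < ⊤ := by
    intro u
    obtain ⟨m, hm⟩ := exists_nat_ge |u|
    refine lt_of_le_of_lt ?_ (hint m)
    refine lintegral_mono_ae ?_
    filter_upwards [hνA] with r hr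
    rw [hψ'A r hr]
    exact le_iSup₂_of_le u (abs_le.1 hm) le_rfl
  have hψi : ∀ u, Integrable (fun r => ψ' r u) ν := fun u =>
    ⟨(hψ'u u).aestronglyMeasurable, hfin u⟩
  have hci : Integrable c ν := by
    refine ((hψi 1).norm.const_mul 2).mono' hcm.aestronglyMeasurable (ae_of_all _ fun r => ?_)
    rw [Real.norm_of_nonneg (hT r).1]
    exact (hT r).c_le
  let κ : ProbabilityTheory.Kernel ℝ ℝ := ⟨K, hKm⟩
  have lint : ∀ f : ℝ → ℝ≥0∞, Measurable f → ∫⁻ x, f x ∂(ν.bind κ) = ∫⁻ r, ∫⁻ x, f x ∂(K r) ∂ν :=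
    fun f hf => Measure.lintegral_bind hKm.aemeasurable hf.aemeasurable
  have hmm : Measurable fun x : ℝ => ENNReal.ofReal (min (x ^ 2) 1) := by fun_prop
  have B1 : ∫⁻ x, ENNReal.ofReal (min (x ^ 2) 1) ∂(ν.bind κ) < ⊤ := by
    rw [lint _ hmm]
    have : ∫⁻ r, (∫⁻ x, ENNReal.ofReal (min (x ^ 2) 1) ∂(K r)) ∂ν ≤
        ∫⁻ r, 40 * (⨆ u ∈ Set.Icc (-((1 : ℕ) : ℝ)) ((1 : ℕ) : ℝ), (‖ψ r u‖₊ : ℝ≥0∞)) ∂ν := by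
      refine lintegral_mono_ae ?_
      filter_upwards [hνA] with r hr
      rw [← hψ'A r hr]
      exact (hT r).lint_min_le
    refine this.trans_lt ?_
    rw [lintegral_const_mul' _ _ (by simp)]
    exact ENNReal.mul_lt_top (by simp) (hint 1)
  have B2 : ∫⁻ x in Set.Ioi (1 : ℝ), ENNReal.ofReal (Real.exp x) ∂(ν.bind κ) < ⊤ := by
    rw [lint_eF, lint _ eF_meas.ennreal_ofReal]
    have : ∫⁻ r, (∫⁻ x, ENNReal.ofReal (eF x) ∂(K r)) ∂ν ≤
        ∫⁻ r, (4 * ‖ψ' r 1‖ₑ + 24 * ∫⁻ x : ℝ, ENNReal.ofReal (min (x ^ 2) 1) ∂(K r)) ∂ν := by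
      refine lintegral_mono fun r => ?_
      rw [← lint_eF]
      exact (hT r).lint_exp_le
    refine this.trans_lt ?_
    rw [lintegral_add_left ((hψ'u 1).enorm.const_mul 4), lintegral_const_mul' _ _ (by simp),
      lintegral_const_mul' _ _ (by simp), ← lint _ hmm]
    exact ENNReal.add_lt_top.2 ⟨ENNReal.mul_lt_top (by simp) (hfin 1), ENNReal.mul_lt_top (by simp) B1⟩
  have hm : ∀ x : ℝ, 0 ≤ min (x ^ 2) 1 := fun x => le_min (sq_nonneg _) zero_le_one
  have hgi : ∀ u, Integrable (gF u) (ν.bind κ) := by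
    intro u
    have i1 : Integrable (fun x : ℝ => min (x ^ 2) 1) (ν.bind κ) := by
      refine ⟨by fun_prop, ?_⟩
      rw [hasFiniteIntegral_iff_ofReal (ae_of_all _ hm)]
      exact B1
    have i2 : Integrable eF (ν.bind κ) := by
      refine ⟨eF_meas.aestronglyMeasurable, ?_⟩
      rw [hasFiniteIntegral_iff_ofReal (ae_of_all _ eF_nonneg), ← lint_eF]
      exact B2
    exact ((i1.add i2).const_mul (3 * u ^ 2 + |u| + 2)).mono' (gF_meas u).aestronglyMeasurable
      (ae_of_all _ (gF_bound u))
  change ∃ c' K', IsTrip _ c' K'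
  refine ⟨∫ r, c r ∂ν, ν.bind κ, integral_nonneg fun r => (hT r).1, ?_, B1, B2, hgi, ?_⟩
  · rw [Measure.bind_apply (measurableSet_singleton 0) κ.aemeasurable]
    change ∫⁻ r, K r {0} ∂ν = 0
    simp [fun r => (hT r).2.1]
  · intro u
    have e1 : ∫ r in A, ψ r u ∂μ = ∫ r, ψ' r u ∂ν :=
      setIntegral_congr_fun hA fun r hr => by simp only [hψ'A r hr]
    have e2 : ∫ x, gF u x ∂(ν.bind κ) = ∫ r, ∫ x, gF u x ∂(K r) ∂ν :=
      ProbabilityTheory.Kernel.integral_comp (κ := ProbabilityTheory.Kernel.const Unit ν)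
        (η := κ) (a := ()) (hgi u)
    have hi2 : Integrable (fun r => ∫ x, gF u x ∂(K r)) ν := by
      have : (fun r => ∫ x, gF u x ∂(K r)) = fun r => ψ' r u -
          -(((u : ℂ) ^ 2 + Complex.I * (u : ℂ)) / 2) * (c r : ℂ) := by
        ext r
        rw [(hT r).2.2.2.2.2 u]; ring
      rw [this]
      exact (hψi u).sub (hci.ofReal.const_mul _)
    change ∫ r in A, ψ r u ∂μ = _
    have hi1 : Integrable (fun r => -(((u : ℂ) ^ 2 + Complex.I * (u : ℂ)) / 2) * (c r : ℂ)) ν :=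
      hci.ofReal.const_mul _
    rw [e1, e2, integral_congr_ae (ae_of_all _ fun r => (hT r).2.2.2.2.2 u),
      integral_add hi1 hi2, integral_const_mul]
    congr 2
    exact integral_ofReal
end

section
/- Π (the set of Lévy exponents ψ with c ≥ 0, Lévy measure K satisfying ∫_{x>1}e^x K(dx) < ∞, written in the martingale parametrization so that the corresponding infinitely divisible law has exponential moment 1) is a Borel subset of the space E of continuous functions ℝ → ℂ equipped with the topology of uniform convergence on compact sets. -/
open MeasureTheory Filter Topology ENNReal

namespace LevyPi

/-- The Lévy–Khintchine integrand. -/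
noncomputable def ig (u x : ℝ) : ℂ :=
  Complex.exp (Complex.I * (u : ℂ) * (x : ℂ)) - 1 -
        Complex.I * (u : ℂ) * ((Real.exp x - 1 : ℝ) : ℂ)

/-- The weight. -/
noncomputable def w (x : ℝ) : ℝ := min (x ^ 2) 1 + if 1 < x then Real.exp x else 0

/-- The normalised integrand. -/
noncomputable def g (u x : ℝ) : ℂ :=
  if x = 0 then -(((u : ℂ) ^ 2 + Complex.I * (u : ℂ)) / 2) else ig u x / (w x : ℂ)

/-- The second difference of the normalised integrand. -/
noncomputable def h (s x : ℝ) : ℝ :=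
  if x = 0 then s ^ 2 else (2 - 2 * Real.cos (s * x)) / w x

/-- The bound. -/
noncomputable def B (u : ℝ) : ℝ := 3 * u ^ 2 + |u| + 2

lemma w_nonneg (x : ℝ) : 0 ≤ w x := by
  unfold w
  split_ifs <;> positivity

lemma w_pos {x : ℝ} (hx : x ≠ 0) : 0 < w x := by
  unfold w
  have : 0 < min (x ^ 2) 1 := lt_min (by positivity) one_pos
  split_ifs <;> positivity

@[simp] lemma w_zero : w 0 = 0 := by simp [w]

lemma measurable_w : Measurable w := by
  unfold w
  refine Measurable.add (by fun_prop) ?_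
  exact Measurable.ite measurableSet_Ioi (by fun_prop) (by fun_prop)

lemma measurable_ig (u : ℝ) : Measurable (ig u) := by
  unfold ig
  fun_prop

lemma measurable_g (u : ℝ) : Measurable (g u) := by
  unfold g
  refine Measurable.ite (measurableSet_singleton 0) (by fun_prop) ?_
  exact (measurable_ig u).div (Complex.measurable_ofReal.comp measurable_w)

lemma measurable_h (s : ℝ) : Measurable (h s) := by
  unfold h
  refine Measurable.ite (measurableSet_singleton 0) (by fun_prop) ?_
  exact Measurable.div (by fun_prop) measurable_w

lemma continuous_g (x : ℝ) : Continuous (fun u => g u x) := by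
  unfold g ig
  split_ifs <;> fun_prop

lemma continuous_B : Continuous B := by
  unfold B; fun_prop

lemma B_nonneg (u : ℝ) : 0 ≤ B u := by unfold B; positivity

lemma norm_expI (y : ℝ) : ‖Complex.exp (Complex.I * (y : ℂ))‖ = 1 := by
  rw [mul_comm]; exact Complex.norm_exp_ofReal_mul_I y

lemma norm_aux (y : ℝ) : ‖Complex.exp (Complex.I * (y : ℂ)) - 1 - Complex.I * (y : ℂ)‖
    ≤ 3 * y ^ 2 := by
  have hn : ‖Complex.I * (y : ℂ)‖ = |y| := by simp
  rcases le_total |y| 1 with hy | hy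
  · have := Complex.norm_exp_sub_one_sub_id_le (x := Complex.I * (y : ℂ)) (by rw [hn]; exact hy)
    rw [hn, sq_abs] at this
    nlinarith [sq_nonneg y]
  · have h1 := norm_sub_le (Complex.exp (Complex.I * (y : ℂ)) - 1) (Complex.I * (y : ℂ))
    have h2 := norm_sub_le (Complex.exp (Complex.I * (y : ℂ))) 1
    rw [norm_expI, norm_one] at h2
    rw [hn] at h1
    nlinarith [sq_abs y]

lemma norm_ig_le (u x : ℝ) : ‖ig u x‖ ≤ B u * w x := by
  have h2 : ‖Complex.exp (Complex.I * (u : ℂ) * (x : ℂ)) - 1‖ ≤ 2 := by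
    have := norm_sub_le (Complex.exp (Complex.I * ((u * x : ℝ) : ℂ))) 1
    rw [norm_expI, norm_one] at this
    push_cast at this
    rw [← mul_assoc] at this
    linarith
  have h3 : ‖Complex.I * (u : ℂ) * ((Real.exp x - 1 : ℝ) : ℂ)‖ = |u| * |Real.exp x - 1| := by
    rw [norm_mul, norm_mul, Complex.norm_I, one_mul, Complex.norm_real, Complex.norm_real,
      Real.norm_eq_abs, Real.norm_eq_abs]
  have h4 := norm_sub_le (Complex.exp (Complex.I * (u : ℂ) * (x : ℂ)) - 1)
    (Complex.I * (u : ℂ) * ((Real.exp x - 1 : ℝ) : ℂ))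
  rw [h3] at h4
  have hu := abs_nonneg u
  by_cases hx : |x| ≤ 1
  · have hw : w x = x ^ 2 := by
      have h1 := (abs_le.1 hx).2
      have : x ^ 2 ≤ 1 := by rw [← sq_abs]; nlinarith [abs_nonneg x]
      simp [w, this, h1]
    have e : ig u x = (Complex.exp (Complex.I * ((u * x : ℝ) : ℂ)) - 1
        - Complex.I * ((u * x : ℝ) : ℂ))
        - Complex.I * (u : ℂ) * ((Real.exp x - 1 - x : ℝ) : ℂ) := by
      unfold ig; push_cast; ring_nf
    have h5 : ‖Complex.I * (u : ℂ) * ((Real.exp x - 1 - x : ℝ) : ℂ)‖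
        = |u| * |Real.exp x - 1 - x| := by
      rw [norm_mul, norm_mul, Complex.norm_I, one_mul, Complex.norm_real, Complex.norm_real,
        Real.norm_eq_abs, Real.norm_eq_abs]
    have h6 : |Real.exp x - 1 - x| ≤ x ^ 2 := by
      have := Real.norm_exp_sub_one_sub_id_le (x := x) hx
      simpa using this
    rw [e, hw]
    refine (norm_sub_le _ _).trans ?_
    have h7 := norm_aux (u * x)
    have h8 : |u| * |Real.exp x - 1 - x| ≤ |u| * x ^ 2 := by gcongr
    rw [h5]
    unfold B
    nlinarith [sq_nonneg x]
  · push Not at hx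
    have hx2 : 1 ≤ x ^ 2 := by rw [← sq_abs]; nlinarith [abs_nonneg x]
    change ‖_ - _‖ ≤ _
    refine h4.trans ?_
    have hp := Real.exp_pos x
    by_cases h1 : 1 < x
    · have hw : w x = 1 + Real.exp x := by simp [w, hx2, h1]
      have : |Real.exp x - 1| ≤ Real.exp x := by
        rw [abs_of_nonneg] <;> linarith [Real.add_one_le_exp x]
      have h8 : |u| * |Real.exp x - 1| ≤ |u| * Real.exp x := by gcongr
      rw [hw]
      unfold B
      nlinarith [sq_nonneg u, mul_nonneg (sq_nonneg u) hp.le]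
    · have hw : w x = 1 := by simp [w, hx2, h1]
      have hx0 : x < 0 := by
        rcases lt_abs.1 hx with h | h <;> linarith
      have : |Real.exp x - 1| ≤ 1 := by
        have := Real.exp_lt_one_iff.2 hx0
        rw [abs_le]; constructor <;> linarith
      have h8 : |u| * |Real.exp x - 1| ≤ |u| * 1 := by gcongr
      rw [hw]
      unfold B
      nlinarith [sq_nonneg u]

lemma norm_g_le (u x : ℝ) : ‖g u x‖ ≤ B u := by
  unfold g
  split_ifs with hx
  · rw [norm_neg, norm_div]
    have := norm_add_le ((u : ℂ) ^ 2) (Complex.I * (u : ℂ))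
    have h1 : ‖(u : ℂ) ^ 2‖ = u ^ 2 := by simp
    have h2 : ‖Complex.I * (u : ℂ)‖ = |u| := by simp
    rw [h1, h2] at this
    simp only [Complex.norm_ofNat]
    unfold B
    nlinarith [abs_nonneg u, sq_nonneg u]
  · have := w_pos hx
    rw [norm_div, Complex.norm_real, Real.norm_eq_abs, abs_of_pos this, div_le_iff₀ this]
    exact norm_ig_le u x

lemma integrable_g (ρ : Measure ℝ) [IsFiniteMeasure ρ] (u : ℝ) : Integrable (g u) ρ :=
  Integrable.of_bound (measurable_g u).aestronglyMeasurable (B u)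
    (Eventually.of_forall (norm_g_le u))

lemma continuous_integral_g (ρ : Measure ℝ) [IsFiniteMeasure ρ] :
    Continuous (fun u => ∫ x, g u x ∂ρ) := by
  rw [continuous_iff_continuousAt]
  intro u
  refine continuousAt_of_dominated (bound := fun _ => B u + 1)
    (Eventually.of_forall fun v => (measurable_g v).aestronglyMeasurable) ?_
    (integrable_const _) (Eventually.of_forall fun x => (continuous_g x).continuousAt)
  have : ∀ᶠ v in 𝓝 u, B v < B u + 1 :=
    continuous_B.continuousAt.eventually_lt continuousAt_const (by linarith)
  filter_upwards [this] with v hv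
  exact Eventually.of_forall fun x => (norm_g_le v x).trans hv.le

lemma second_diff (s u x : ℝ) :
    Complex.exp ((u : ℂ) * (x : ℂ) * Complex.I) * (h s x : ℂ)
      = -(g (u + s) x + g (u - s) x - 2 * g u x) := by
  unfold g h
  split_ifs with hx
  · subst hx; simp; ring
  · have hw : (w x : ℂ) ≠ 0 := by exact_mod_cast (w_pos hx).ne'
    unfold ig
    have e1 : Complex.I * ((u + s : ℝ) : ℂ) * x = (u : ℂ) * x * Complex.I
        + ((s : ℂ) * x) * Complex.I := by push_cast; ring
    have e2 : Complex.I * ((u - s : ℝ) : ℂ) * x = (u : ℂ) * x * Complex.I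
        + (-((s : ℂ) * x)) * Complex.I := by push_cast; ring
    have e3 : Complex.I * (u : ℂ) * x = (u : ℂ) * x * Complex.I := by ring
    rw [e1, e2, e3, Complex.exp_add, Complex.exp_add]
    push_cast
    rw [Complex.cos]
    field_simp
    ring

lemma h_nonneg (s x : ℝ) : 0 ≤ h s x := by
  unfold h
  split_ifs with hx
  · positivity
  · exact div_nonneg (by linarith [Real.cos_le_one (s * x)]) (w_nonneg x)

lemma h_pos (x : ℝ) : 0 < h 1 x + h (√2) x := by
  by_contra hc
  have a1 := h_nonneg 1 x
  have a2 := h_nonneg (√2) x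
  have b1 : h 1 x = 0 := by linarith
  have b2 : h (√2) x = 0 := by linarith
  unfold h at b1 b2
  split_ifs at b1 b2 with hx
  · norm_num at b1
  · have hw := (w_pos hx).ne'
    rw [_root_.div_eq_zero_iff, or_iff_left hw] at b1 b2
    have c1 : Real.cos (1 * x) = 1 := by linarith
    have c2 : Real.cos (√2 * x) = 1 := by linarith
    rw [Real.cos_eq_one_iff] at c1 c2
    obtain ⟨n, hn⟩ := c1
    obtain ⟨m, hm⟩ := c2
    rw [one_mul] at hn
    have hn0 : (n : ℝ) ≠ 0 := by
      rintro h0; apply hx; rw [← hn, h0, zero_mul]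
    have : √2 = ((m / n : ℚ) : ℝ) := by
      push_cast
      rw [eq_div_iff hn0]
      have hpi : (2 * Real.pi) ≠ 0 := by positivity
      apply mul_right_cancel₀ hpi
      rw [hm, ← hn]; ring
    exact irrational_sqrt_two ⟨_, this.symm⟩

lemma integrable_h (ρ : Measure ℝ) [IsFiniteMeasure ρ] (s : ℝ) : Integrable (h s) ρ := by
  have h1 : Integrable (fun x => -(g (0 + s) x + g (0 - s) x - 2 * g 0 x)) ρ :=
    (((integrable_g ρ _).add (integrable_g ρ _)).sub ((integrable_g ρ _).const_mul 2)).neg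
  simp_rw [← second_diff] at h1
  have h2 := h1.re
  simpa using h2

lemma charFun_h (ρ : Measure ℝ) [IsFiniteMeasure ρ] (s u : ℝ) :
    charFun (ρ.withDensity (fun x => ENNReal.ofReal (h s x))) u
      = -(∫ x, g (u + s) x ∂ρ + ∫ x, g (u - s) x ∂ρ - 2 * ∫ x, g u x ∂ρ) := by
  rw [charFun_apply_real]
  have := integral_withDensity_eq_integral_smul (μ := ρ) (measurable_h s).real_toNNReal
    (fun x : ℝ => Complex.exp (u * x * Complex.I))
  change ∫ x : ℝ, Complex.exp (u * x * Complex.I)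
    ∂(ρ.withDensity (fun x => ((h s x).toNNReal : ℝ≥0∞))) = _
  rw [this]
  have e : ∀ x : ℝ, (h s x).toNNReal • Complex.exp (u * x * Complex.I)
      = -(g (u + s) x + g (u - s) x - 2 * g u x) := by
    intro x
    rw [← second_diff, NNReal.smul_def, Real.coe_toNNReal _ (h_nonneg s x), Complex.real_smul,
      mul_comm]
  simp_rw [e]
  rw [integral_neg, integral_sub, integral_add, integral_const_mul]
  · exact integrable_g ρ _
  · exact integrable_g ρ _
  · exact (integrable_g ρ _).add (integrable_g ρ _)
  · exact (integrable_g ρ _).const_mul 2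

lemma unique (ρ₁ ρ₂ : Measure ℝ) [IsFiniteMeasure ρ₁] [IsFiniteMeasure ρ₂]
    (H : ∀ u, ∫ x, g u x ∂ρ₁ = ∫ x, g u x ∂ρ₂) : ρ₁ = ρ₂ := by
  have key : ∀ s, ρ₁.withDensity (fun x => ENNReal.ofReal (h s x))
      = ρ₂.withDensity (fun x => ENNReal.ofReal (h s x)) := by
    intro s
    have i1 := isFiniteMeasure_withDensity_ofReal (integrable_h ρ₁ s).2
    have i2 := isFiniteMeasure_withDensity_ofReal (integrable_h ρ₂ s).2
    apply Measure.ext_of_charFun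
    ext u
    rw [charFun_h, charFun_h, H, H, H]
  let f : ℝ → ℝ≥0∞ := (fun x => ENNReal.ofReal (h 1 x)) + fun x => ENNReal.ofReal (h (√2) x)
  have hf : Measurable f :=
    (measurable_h 1).ennreal_ofReal.add (measurable_h (√2)).ennreal_ofReal
  have k2 : ρ₁.withDensity f = ρ₂.withDensity f := by
    simp only [f]
    rw [withDensity_add_left (measurable_h 1).ennreal_ofReal,
      withDensity_add_left (measurable_h 1).ennreal_ofReal, key, key]
  have f0 : ∀ x, f x ≠ 0 := by
    intro x
    simp only [f, Pi.add_apply]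
    rw [← ENNReal.ofReal_add (h_nonneg _ _) (h_nonneg _ _)]
    exact (ENNReal.ofReal_pos.2 (h_pos x)).ne'
  have ft : ∀ x, f x ≠ ∞ := by
    intro x
    simp [f]
  rw [← withDensity_inv_same (μ := ρ₁) hf (.of_forall f0) (.of_forall ft), k2,
    withDensity_inv_same (μ := ρ₂) hf (.of_forall f0) (.of_forall ft)]

lemma measurable_wN : Measurable (fun x => (w x).toNNReal) := measurable_w.real_toNNReal

lemma wN_smul (u x : ℝ) : (w x).toNNReal • g u x = ig u x := by
  rw [NNReal.smul_def, Real.coe_toNNReal _ (w_nonneg x), Complex.real_smul]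
  unfold g
  split_ifs with hx
  · subst hx; simp [ig]
  · have hw : (w x : ℂ) ≠ 0 := by exact_mod_cast (w_pos hx).ne'
    field_simp

lemma wN_inv_smul (u : ℝ) {x : ℝ} (hx : x ≠ 0) : (w x)⁻¹.toNNReal • ig u x = g u x := by
  rw [NNReal.smul_def, Real.coe_toNNReal _ (inv_nonneg.2 (w_nonneg x)), Complex.real_smul]
  unfold g
  rw [if_neg hx]
  push_cast
  rw [div_eq_inv_mul]

lemma ofReal_w (x : ℝ) : ENNReal.ofReal (w x) = ENNReal.ofReal (min (x ^ 2) 1)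
    + (Set.Ioi (1 : ℝ)).indicator (fun x => ENNReal.ofReal (Real.exp x)) x := by
  unfold w
  rw [ENNReal.ofReal_add (by positivity) (by split_ifs <;> positivity)]
  congr 1
  by_cases hx : 1 < x <;> simp [hx]

lemma lintegral_w (K : Measure ℝ) : ∫⁻ x, ENNReal.ofReal (w x) ∂K =
    (∫⁻ x, ENNReal.ofReal (min (x ^ 2) 1) ∂K)
      + ∫⁻ x in Set.Ioi (1 : ℝ), ENNReal.ofReal (Real.exp x) ∂K := by
  simp_rw [ofReal_w]
  rw [lintegral_add_left (by fun_prop), lintegral_indicator measurableSet_Ioi]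

lemma memPi_iff (ψ : ℝ → ℂ) :
    MemPi ψ ↔ ∃ ρ : Measure ℝ, IsFiniteMeasure ρ ∧ ∀ u, ψ u = ∫ x, g u x ∂ρ := by
  constructor
  · rintro ⟨c, K, hc, hK0, h1, h2, hint, hψ⟩
    have hfin : IsFiniteMeasure (K.withDensity (fun x => ((w x).toNNReal : ℝ≥0∞))) := by
      apply isFiniteMeasure_withDensity
      change ∫⁻ x, ENNReal.ofReal (w x) ∂K ≠ ∞
      rw [lintegral_w]
      exact (ENNReal.add_lt_top.2 ⟨h1, h2⟩).ne
    refine ⟨ENNReal.ofReal c • Measure.dirac 0 + K.withDensity (fun x => ((w x).toNNReal : ℝ≥0∞)),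
      ?_, ?_⟩
    · have : IsFiniteMeasure (ENNReal.ofReal c • Measure.dirac (0 : ℝ)) :=
        Measure.smul_finite _ ENNReal.ofReal_ne_top
      infer_instance
    · intro u
      have : IsFiniteMeasure (ENNReal.ofReal c • Measure.dirac (0 : ℝ)) :=
        Measure.smul_finite _ ENNReal.ofReal_ne_top
      rw [integral_add_measure (integrable_g _ u) (integrable_g _ u), integral_smul_measure,
        integral_dirac, integral_withDensity_eq_integral_smul measurable_wN, hψ u]
      simp_rw [wN_smul]
      congr 1
      rw [ENNReal.toReal_ofReal hc, Complex.real_smul, mul_comm]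
      simp [g]
  · rintro ⟨ρ, hρ, hψ⟩
    let ρ' := ρ.restrict {0}ᶜ
    have hm : Measurable (fun x => (w x)⁻¹.toNNReal) := measurable_w.inv.real_toNNReal
    let K := ρ'.withDensity (fun x => ((w x)⁻¹.toNNReal : ℝ≥0∞))
    have hae : ∀ᵐ x ∂ρ', x ≠ 0 := ae_restrict_mem (measurableSet_singleton (0 : ℝ)).compl
    have hlt : ∫⁻ x, ENNReal.ofReal (w x) ∂K < ∞ := by
      rw [lintegral_withDensity_eq_lintegral_mul _ hm.coe_nnreal_ennreal
        measurable_w.ennreal_ofReal]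
      refine lt_of_le_of_lt (lintegral_mono (g := fun _ => 1) ?_)
        (by simpa using measure_lt_top ρ' _)
      intro x
      change ENNReal.ofReal (w x)⁻¹ * ENNReal.ofReal (w x) ≤ 1
      rw [← ENNReal.ofReal_mul (inv_nonneg.2 (w_nonneg x))]
      exact ENNReal.ofReal_le_one.2 (inv_mul_le_one)
    rw [lintegral_w, ENNReal.add_lt_top] at hlt
    have hsm : ∀ u, (fun x => (w x)⁻¹.toNNReal • ig u x) =ᵐ[ρ'] g u := by
      intro u
      filter_upwards [hae] with x hx
      exact wN_inv_smul u hx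
    refine ⟨ρ.real {0}, K, measureReal_nonneg, ?_, hlt.1, hlt.2, ?_, ?_⟩
    · apply withDensity_absolutelyContinuous
      simp [ρ']
    · intro u
      change Integrable (ig u) K
      rw [integrable_withDensity_iff_integrable_smul hm, integrable_congr (hsm u)]
      exact integrable_g ρ' u
    · intro u
      change ψ u = _ + ∫ x, ig u x ∂K
      rw [integral_withDensity_eq_integral_smul hm, integral_congr_ae (hsm u), hψ u,
        ← integral_add_compl (measurableSet_singleton (0 : ℝ)) (integrable_g ρ u)]
      congr 1
      rw [integral_singleton, Complex.real_smul, mul_comm]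
      simp [g]

open ProbabilityTheory in
/-- The kernel attached to rational cumulative distribution functions. -/
noncomputable def κ : Kernel (ℚ → ℝ) ℝ where
  toFun a := (stieltjesOfMeasurableRat (fun a : ℚ → ℝ => a) measurable_id a).measure
  measurable' := measurable_measure_stieltjesOfMeasurableRat measurable_id

open ProbabilityTheory in
instance (a : ℚ → ℝ) : IsProbabilityMeasure (κ a) :=
  instIsProbabilityMeasure_stieltjesOfMeasurableRat measurable_id a

open ProbabilityTheory in
lemma κ_inj {a b : ℚ → ℝ} (ha : IsRatStieltjesPoint (fun a : ℚ → ℝ => a) a)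
    (hb : IsRatStieltjesPoint (fun a : ℚ → ℝ => a) b) (hab : κ a = κ b) : a = b := by
  have key : ∀ c : ℚ → ℝ, IsRatStieltjesPoint (fun a : ℚ → ℝ => a) c → ∀ q : ℚ,
      cdf (κ c) q = c q := by
    intro c hc q
    change cdf ((stieltjesOfMeasurableRat (fun a : ℚ → ℝ => a) measurable_id c).measure) q = c q
    rw [cdf_measure_stieltjesFunction _ (tendsto_stieltjesOfMeasurableRat_atBot _ _)
      (tendsto_stieltjesOfMeasurableRat_atTop _ _), stieltjesOfMeasurableRat_eq,
      toRatCDF_of_isRatStieltjesPoint hc]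
  ext q
  rw [← key a ha, ← key b hb, hab]

open ProbabilityTheory in
lemma κ_surj (P : Measure ℝ) [IsProbabilityMeasure P] :
    ∃ a, IsRatStieltjesPoint (fun a : ℚ → ℝ => a) a ∧ κ a = P := by
  have hS : IsRatStieltjesPoint (fun a : ℚ → ℝ => a) (fun q : ℚ => cdf P q) := by
    refine ⟨fun q r hqr => monotone_cdf P (by exact_mod_cast hqr),
      (tendsto_cdf_atTop P).comp (tendsto_ratCast_atTop_iff.2 tendsto_id), ?_, ?_⟩
    · exact (tendsto_cdf_atBot P).comp (tendsto_ratCast_atBot_iff.2 tendsto_id)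
    · intro t
      have := (cdf P).iInf_rat_gt_eq t
      refine Eq.trans ?_ this
      refine Equiv.iInf_congr (Equiv.subtypeEquivRight ?_) ?_
      · intro r; simp
      · intro r; rfl
  refine ⟨_, hS, ?_⟩
  refine Measure.eq_of_cdf _ _ ?_
  change cdf ((stieltjesOfMeasurableRat (fun a : ℚ → ℝ => a) measurable_id _).measure) = _
  rw [cdf_measure_stieltjesFunction _ (tendsto_stieltjesOfMeasurableRat_atBot _ _)
      (tendsto_stieltjesOfMeasurableRat_atTop _ _)]
  ext x
  rw [← StieltjesFunction.iInf_rat_gt_eq, ← (cdf P).iInf_rat_gt_eq x]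
  refine iInf_congr fun r => ?_
  rw [stieltjesOfMeasurableRat_eq, toRatCDF_of_isRatStieltjesPoint hS]

/-- The parametrisation, restricted to rational arguments. -/
noncomputable def Φ (p : (ℚ → ℝ) × ℝ) : ℚ → ℂ := fun q => (p.2 : ℂ) * ∫ x, g q x ∂(κ p.1)

lemma measurable_Φ : Measurable Φ := by
  refine measurable_pi_lambda _ fun q => ?_
  refine Measurable.mul (by fun_prop) ?_
  have : Measurable (fun a => ∫ x, g q x ∂(κ a)) :=
    ((measurable_g q).stronglyMeasurable.integral_kernel (κ := κ)).measurable
  exact this.comp measurable_fst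

/-- The parameter set. -/
def S : Set ((ℚ → ℝ) × ℝ) :=
  {a | ProbabilityTheory.IsRatStieltjesPoint (fun a : ℚ → ℝ => a) a} ×ˢ Set.Ioi 0

lemma measurableSet_S : MeasurableSet S :=
  (ProbabilityTheory.measurableSet_isRatStieltjesPoint measurable_id).prod measurableSet_Ioi

lemma eq_of_rat {f f' : ℝ → ℂ} (hf : Continuous f) (hf' : Continuous f')
    (hq : ∀ q : ℚ, f q = f' q) : f = f' :=
  Rat.isDenseEmbedding_coe_real.dense.equalizer hf hf' (funext hq)

lemma integral_smul_κ (a : ℚ → ℝ) {m : ℝ} (hm : 0 < m) (u : ℝ) :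
    ∫ x, g u x ∂(ENNReal.ofReal m • κ a) = (m : ℂ) * ∫ x, g u x ∂(κ a) := by
  rw [integral_smul_measure, ENNReal.toReal_ofReal hm.le, Complex.real_smul]

lemma injOn_Φ : Set.InjOn Φ S := by
  rintro ⟨a, m⟩ ⟨ha, hm⟩ ⟨b, n⟩ ⟨hb, hn⟩ hab
  simp only [Set.mem_Ioi] at hm hn
  have i1 : IsFiniteMeasure (ENNReal.ofReal m • κ a) := Measure.smul_finite _ ENNReal.ofReal_ne_top
  have i2 : IsFiniteMeasure (ENNReal.ofReal n • κ b) := Measure.smul_finite _ ENNReal.ofReal_ne_top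
  have e : ENNReal.ofReal m • κ a = ENNReal.ofReal n • κ b := by
    apply unique
    intro u
    refine congrFun (eq_of_rat (continuous_integral_g _) (continuous_integral_g _) ?_) u
    intro q
    rw [integral_smul_κ a hm, integral_smul_κ b hn]
    exact congrFun hab q
  have hmn : m = n := by
    have := congrArg (fun μ : Measure ℝ => μ Set.univ) e
    simp only [Measure.smul_apply, measure_univ, smul_eq_mul, mul_one] at this
    exact (ENNReal.ofReal_eq_ofReal_iff hm.le hn.le).1 this
  subst hmn
  have hκ : κ a = κ b := by
    ext s hs
    have := congrArg (fun μ : Measure ℝ => μ s) e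
    simp only [Measure.smul_apply, smul_eq_mul] at this
    exact (ENNReal.mul_right_inj (ENNReal.ofReal_pos.2 hm).ne' ENNReal.ofReal_ne_top).1 this
  have hfin : a = b := κ_inj ha hb hκ
  rw [hfin]

lemma memPi_iff' (ψ : C(ℝ, ℂ)) :
    MemPi (fun u => ψ u) ↔ (fun q : ℚ => ψ q) ∈ Φ '' S ∪ {0} := by
  rw [memPi_iff]
  constructor
  · rintro ⟨ρ, hρ, hψ⟩
    by_cases h0 : ρ = 0
    · right
      ext q
      simp [hψ, h0]
    · left
      have : NeZero ρ := ⟨h0⟩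
      obtain ⟨a, ha, hP⟩ := κ_surj ((ρ Set.univ)⁻¹ • ρ)
      have hpos : 0 < ρ.real Set.univ := by
        rw [measureReal_def]
        exact ENNReal.toReal_pos (by simpa using h0) (measure_ne_top _ _)
      refine ⟨(a, ρ.real Set.univ), ⟨ha, hpos⟩, ?_⟩
      ext q
      change ((ρ.real Set.univ : ℝ) : ℂ) * ∫ x, g q x ∂(κ a) = ψ q
      rw [hψ q, hP, integral_smul_measure, Complex.real_smul, ← mul_assoc, ENNReal.toReal_inv,
        ← measureReal_def, ← Complex.ofReal_mul, mul_inv_cancel₀ hpos.ne', Complex.ofReal_one,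
        one_mul]
  · rintro (⟨⟨a, m⟩, ⟨ha, hm⟩, hψ⟩ | h0)
    · simp only [Set.mem_Ioi] at hm
      have i1 : IsFiniteMeasure (ENNReal.ofReal m • κ a) :=
        Measure.smul_finite _ ENNReal.ofReal_ne_top
      refine ⟨ENNReal.ofReal m • κ a, i1, fun u => ?_⟩
      refine congrFun (eq_of_rat ψ.continuous (continuous_integral_g _) ?_) u
      intro q
      rw [integral_smul_κ a hm]
      exact (congrFun hψ q).symm
    · refine ⟨0, inferInstance, fun u => ?_⟩
      refine congrFun (eq_of_rat ψ.continuous (continuous_integral_g _) ?_) u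
      intro q
      rw [integral_zero_measure]
      exact congrFun h0 q

end LevyPi

/-- `Π` is a Borel subset of the space `E = C(ℝ, ℂ)` of continuous
functions with the topology of uniform convergence on compact sets (the
compact-open topology). -/
theorem stmt16 :
    MeasurableSet[borel C(ℝ, ℂ)] {ψ : C(ℝ, ℂ) | MemPi (fun u => ψ u)} := by
  letI : MeasurableSpace C(ℝ, ℂ) := borel C(ℝ, ℂ)
  haveI : BorelSpace C(ℝ, ℂ) := ⟨rfl⟩
  have hr : Measurable (fun (ψ : C(ℝ, ℂ)) (q : ℚ) => ψ q) := by
    refine measurable_pi_lambda _ fun q => ?_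
    exact (continuous_eval_const (q : ℝ)).measurable
  have hS : MeasurableSet (LevyPi.Φ '' LevyPi.S ∪ {0}) :=
    (LevyPi.measurableSet_S.image_of_measurable_injOn LevyPi.measurable_Φ LevyPi.injOn_Φ).union
      (measurableSet_singleton 0)
  have := hr hS
  convert this using 1
  ext ψ
  exact LevyPi.memPi_iff' ψ
end
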